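/- Let j = e^{2πi/3}, and for a complex number w with |w| < 1 set G(w) = ∏_{n≥1} (1−w^n)⁴/(1−w^{2n})². Then for every complex number q with |q| < 1: ∏_{n≥1} (1−q^n)²/(1−q^n+q^{2n}) = (1/4)·G(q) + ((1−j)/4)·G(jq) + ((1−j²)/4)·G(j²q). -/

import Mathlib

open Complex in
/-- The primitive cube root of unity `j = e^{2πi/3}`. -/
noncomputable def j : ℂ := Complex.exp (2 * Real.pi * Complex.I / 3)

/-- `G w = ∏_{n ≥ 1} (1 − w^n)⁴ / (1 − w^{2n})²`, the q-expansion of `η(z)⁴/η(2z)²`. -/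
noncomputable def G (w : ℂ) : ℂ :=
  ∏' n : ℕ, (1 - w ^ (n + 1)) ^ 4 / (1 - w ^ (2 * (n + 1))) ^ 2

open Filter Topology Finset

/-- The finite `q`-Pochhammer symbol `(q; q)_n`. -/
noncomputable def qPoch (q : ℂ) (n : ℕ) : ℂ := ∏ i ∈ range n, (1 - q ^ (i + 1))

/-- The reciprocal of `(q; q)_k`, extended by zero to negative `k`. -/
noncomputable def invQPoch (q : ℂ) : ℤ → ℂ
  | Int.ofNat n => (qPoch q n)⁻¹
  | Int.negSucc _ => 0

lemma norm_pow_lt_one {q : ℂ} (hq : ‖q‖ < 1) {n : ℕ} (hn : n ≠ 0) : ‖q ^ n‖ < 1 := by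
  rw [norm_pow]
  exact pow_lt_one₀ (norm_nonneg _) hq hn

lemma one_sub_pow_ne_zero {q : ℂ} (hq : ‖q‖ < 1) {n : ℕ} (hn : n ≠ 0) : 1 - q ^ n ≠ 0 := by
  intro h
  have h1 := norm_pow_lt_one hq hn
  rw [← sub_eq_zero.mp h] at h1
  simp at h1

lemma qPoch_ne_zero {q : ℂ} (hq : ‖q‖ < 1) (n : ℕ) : qPoch q n ≠ 0 :=
  prod_ne_zero_iff.mpr fun _ _ ↦ one_sub_pow_ne_zero hq (Nat.succ_ne_zero _)

lemma invQPoch_sub_one {q : ℂ} (hq : ‖q‖ < 1) (k : ℤ) :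
    invQPoch q (k - 1) = (1 - q ^ k) * invQPoch q k := by
  match k with
  | Int.ofNat 0 =>
    change (0 : ℂ) = (1 - q ^ (0 : ℤ)) * _
    simp
  | Int.ofNat (n + 1) =>
    have h1 := qPoch_ne_zero hq n
    have h2 := one_sub_pow_ne_zero hq (Nat.succ_ne_zero n)
    rw [show Int.ofNat (n + 1) - 1 = Int.ofNat n by simp]
    simp only [invQPoch, qPoch, prod_range_succ, Int.ofNat_eq_natCast, zpow_natCast] at h1 h2 ⊢
    field_simp
  | Int.negSucc n =>
    rw [show Int.negSucc n - 1 = Int.negSucc (n + 1) from rfl]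
    simp [invQPoch]

lemma hasSum_finite_jacobi_triple_product {q z : ℂ} (hq : ‖q‖ < 1) (hq0 : q ≠ 0) (hz : z ≠ 0)
    (N : ℕ) :
    HasSum (fun n : ℤ ↦ z ^ n * q ^ (n ^ 2) *
        (qPoch (q ^ 2) (2 * N) * invQPoch (q ^ 2) (N + n) * invQPoch (q ^ 2) (N - n)))
      (∏ k ∈ range N, ((1 + z * q ^ (2 * k + 1)) * (1 + z⁻¹ * q ^ (2 * k + 1)))) := by
  have hQ : ‖q ^ 2‖ < 1 := norm_pow_lt_one hq two_ne_zero
  induction N with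
  | zero =>
    have h0 : invQPoch (q ^ 2) 0 = 1 := by
      change (qPoch (q ^ 2) 0)⁻¹ = 1
      simp [qPoch]
    convert hasSum_single (0 : ℤ) ?_ using 1
    · simp [qPoch, h0]
    · intro n hn
      rcases lt_or_gt_of_ne hn with h | h
      · obtain ⟨m, rfl⟩ := Int.eq_negSucc_of_lt_zero h
        simp [invQPoch]
      · obtain ⟨m, hm⟩ := Int.eq_negSucc_of_lt_zero (neg_neg_of_pos h)
        simp [hm, invQPoch]
  | succ N ih =>
    have hP (P : ℂ) : P * ((1 + z * q ^ (2 * N + 1)) * (1 + z⁻¹ * q ^ (2 * N + 1))) =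
        (1 + q ^ (4 * N + 2)) * P +
          (z * q ^ (2 * N + 1) * P + z⁻¹ * q ^ (2 * N + 1) * P) := by
      field_simp
      ring
    rw [prod_range_succ, hP]
    have hm := (Equiv.hasSum_iff (Equiv.subRight (1 : ℤ))).mpr ih
    have hp := (Equiv.hasSum_iff (Equiv.addRight (1 : ℤ))).mpr ih
    have := (ih.mul_left (1 + q ^ (4 * N + 2))).add
      ((hm.mul_left (z * q ^ (2 * N + 1))).add (hp.mul_left (z⁻¹ * q ^ (2 * N + 1))))
    refine this.congr_fun fun n ↦ ?_
    simp only [Function.comp, Equiv.subRight_apply, Equiv.coe_addRight]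
    have e1 := invQPoch_sub_one hQ (N + 1 + n)
    have e2 := invQPoch_sub_one hQ (N + 1 + n - 1)
    have e3 := invQPoch_sub_one hQ (N + 1 - n)
    have e4 := invQPoch_sub_one hQ (N + 1 - n - 1)
    rw [show ((N + 1 : ℕ) : ℤ) = (N : ℤ) + 1 by push_cast; ring,
      show (N : ℤ) + n = N + 1 + n - 1 by ring, show (N : ℤ) - n = N + 1 - n - 1 by ring,
      show (N : ℤ) + (n - 1) = N + 1 + n - 1 - 1 by ring,
      show (N : ℤ) - (n - 1) = N + 1 - n by ring,
      show (N : ℤ) + (n + 1) = N + 1 + n by ring,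
      show (N : ℤ) - (n + 1) = N + 1 - n - 1 - 1 by ring, e2, e1, e4, e3,
      show 2 * (N + 1) = 2 * N + 1 + 1 by ring, qPoch, qPoch, prod_range_succ, prod_range_succ]
    generalize invQPoch (q ^ 2) (N + 1 + n) = X
    generalize invQPoch (q ^ 2) (N + 1 - n) = Y
    generalize ∏ i ∈ range (2 * N), (1 - (q ^ 2) ^ (i + 1)) = P
    have hQ0 : q ^ 2 ≠ 0 := pow_ne_zero 2 hq0
    have f (e : ℤ) : (q ^ 2) ^ e = (q ^ e) ^ 2 := by
      rw [← zpow_natCast, ← zpow_natCast, ← zpow_mul, ← zpow_mul, mul_comm]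
    rw [show (n - 1) ^ 2 = n ^ 2 + -n + -n + 1 by ring,
      show (n + 1) ^ 2 = n ^ 2 + n + n + 1 by ring]
    simp only [f, zpow_add₀ hq0, zpow_sub₀ hq0, zpow_add₀ hz, zpow_sub₀ hz, zpow_neg,
      zpow_natCast, zpow_one, pow_add, pow_mul, pow_one]
    have ht : q ^ n ≠ 0 := zpow_ne_zero _ hq0
    have hs : z ^ n ≠ 0 := zpow_ne_zero _ hz
    generalize q ^ (n ^ 2) = s
    generalize q ^ n = t at *
    generalize z ^ n = u at *
    rw [show (q ^ 4) ^ N = (q ^ N) ^ 4 by ring, show (q ^ 2) ^ N = (q ^ N) ^ 2 by ring,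
      show ((q ^ 2) ^ 2) ^ N = (q ^ N) ^ 4 by ring]
    generalize q ^ N = m
    field_simp
    ring

lemma multipliable_one_sub_mul_pow {q : ℂ} (hq : ‖q‖ < 1) (c : ℂ) {g : ℕ → ℕ}
    (hg : g.Injective) : Multipliable fun n ↦ 1 - c * q ^ g n := by
  simp only [sub_eq_add_neg]
  apply multipliable_one_add_of_summable
  simpa using! ((summable_geometric_of_lt_one (norm_nonneg _) hq).comp_injective hg).mul_left ‖c‖

/-- The Euler product `∏_{n ≥ 1} (1 - q ^ n)`. -/
noncomputable def eulerProd (q : ℂ) : ℂ := ∏' n : ℕ, (1 - q ^ (n + 1))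

lemma hasProd_eulerProd {q : ℂ} (hq : ‖q‖ < 1) :
    HasProd (fun n : ℕ ↦ 1 - q ^ (n + 1)) (eulerProd q) :=
  (ModularForm.multipliable_one_sub_pow hq).hasProd

lemma eulerProd_ne_zero {q : ℂ} (hq : ‖q‖ < 1) : eulerProd q ≠ 0 := by
  refine tprod_one_add_ne_zero_of_summable (f := fun n ↦ -q ^ (n + 1)) ?_ ?_
  · exact fun i ↦ by simpa [sub_eq_add_neg] using one_sub_pow_ne_zero hq (Nat.succ_ne_zero i)
  · simpa using (summable_nat_add_iff 1).mpr (summable_geometric_of_lt_one (norm_nonneg _) hq)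

lemma tendsto_qPoch {q : ℂ} (hq : ‖q‖ < 1) : Tendsto (qPoch q) atTop (𝓝 (eulerProd q)) :=
  (hasProd_eulerProd hq).tendsto_prod_nat

lemma tendsto_invQPoch {q : ℂ} (hq : ‖q‖ < 1) :
    Tendsto (invQPoch q) atTop (𝓝 (eulerProd q)⁻¹) := by
  rw [← Nat.map_cast_int_atTop, tendsto_map'_iff]
  exact (tendsto_qPoch hq).inv₀ (eulerProd_ne_zero hq)

lemma exists_norm_invQPoch_le {q : ℂ} (hq : ‖q‖ < 1) : ∃ C, ∀ k, ‖invQPoch q k‖ ≤ C := by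
  obtain ⟨C, hC⟩ := ((tendsto_qPoch hq).inv₀ (eulerProd_ne_zero hq)).norm.bddAbove_range
  refine ⟨C, fun k ↦ ?_⟩
  have h (n : ℕ) : ‖(qPoch q n)⁻¹‖ ≤ C := hC ⟨n, rfl⟩
  match k with
  | Int.ofNat n => exact h n
  | Int.negSucc n => simpa [invQPoch] using (norm_nonneg _).trans (h 0)

lemma summable_zpow_sq {r : ℝ} (hr0 : 0 < r) (hr : r < 1) : Summable fun n : ℤ ↦ r ^ (n ^ 2) := by
  have h : Summable fun n : ℕ ↦ r ^ ((n : ℤ) ^ 2) := by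
    refine (summable_geometric_of_lt_one hr0.le hr).of_nonneg_of_le (fun n ↦ by positivity)
      fun n ↦ ?_
    rw [← Nat.cast_pow, zpow_natCast]
    exact pow_le_pow_of_le_one hr0.le hr.le (Nat.le_self_pow two_ne_zero n)
  exact .of_nat_of_neg h (by simpa using h)

lemma summable_theta {q z : ℂ} (hq : ‖q‖ < 1) (hq0 : q ≠ 0) (hz : ‖z‖ = 1) :
    Summable fun n : ℤ ↦ z ^ n * q ^ (n ^ 2) :=
  .of_norm <| by simpa [norm_zpow, hz] using summable_zpow_sq (norm_pos_iff.mpr hq0) hq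

/-- The **Jacobi triple product** on the unit circle. -/
theorem tsum_zpow_mul_zpow_sq {q z : ℂ} (hq : ‖q‖ < 1) (hq0 : q ≠ 0) (hz : ‖z‖ = 1) :
    ∑' n : ℤ, z ^ n * q ^ (n ^ 2) = eulerProd (q ^ 2) *
      ∏' k : ℕ, ((1 + z * q ^ (2 * k + 1)) * (1 + z⁻¹ * q ^ (2 * k + 1))) := by
  have hz0 : z ≠ 0 := norm_pos_iff.mp (hz ▸ one_pos)
  have hQ : ‖q ^ 2‖ < 1 := norm_pow_lt_one hq two_ne_zero
  have hE := eulerProd_ne_zero hQ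
  have hinj : (fun k : ℕ ↦ 2 * k + 1).Injective := fun a b h ↦ by simpa using h
  have hm (c : ℂ) : Multipliable fun k : ℕ ↦ 1 + c * q ^ (2 * k + 1) := by
    simpa using multipliable_one_sub_mul_pow hq (-c) hinj
  have hprod := ((hm z).mul (hm z⁻¹)).hasProd.tendsto_prod_nat
  obtain ⟨C, hC⟩ := exists_norm_invQPoch_le hQ
  obtain ⟨D, hD⟩ := (tendsto_qPoch hQ).norm.bddAbove_range
  replace hD (n : ℕ) : ‖qPoch (q ^ 2) n‖ ≤ D := hD ⟨n, rfl⟩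
  have hlim : Tendsto (fun N : ℕ ↦ ∑' n : ℤ, z ^ n * q ^ (n ^ 2) *
      (qPoch (q ^ 2) (2 * N) * invQPoch (q ^ 2) (N + n) * invQPoch (q ^ 2) (N - n))) atTop
      (𝓝 (∑' n : ℤ, z ^ n * q ^ (n ^ 2) *
        (eulerProd (q ^ 2) * (eulerProd (q ^ 2))⁻¹ * (eulerProd (q ^ 2))⁻¹))) := by
    refine tendsto_tsum_of_dominated_convergence (bound := fun n ↦ ‖q‖ ^ (n ^ 2) * (D * C * C))
      ((summable_zpow_sq (norm_pos_iff.mpr hq0) hq).mul_right _) (fun n ↦ ?_)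
      (.of_forall fun N n ↦ ?_)
    · have hN : Tendsto (fun N : ℕ ↦ (N : ℤ)) atTop atTop := tendsto_natCast_atTop_atTop
      refine .const_mul _ (((tendsto_qPoch hQ).comp ?_).mul ((tendsto_invQPoch hQ).comp ?_) |>.mul
        ((tendsto_invQPoch hQ).comp ?_))
      · exact tendsto_id.const_mul_atTop' two_pos
      · exact tendsto_atTop_add_const_right _ _ hN
      · simpa [sub_eq_add_neg] using tendsto_atTop_add_const_right _ (-n) hN
    · have hD0 : 0 ≤ D := (norm_nonneg _).trans (hD 0)
      have hC0 : 0 ≤ C := (norm_nonneg _).trans (hC 0)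
      simp only [norm_mul, norm_zpow, hz, one_zpow, one_mul]
      gcongr
      · exact hD _
      · exact hC _
      · exact hC _
  simp only [fun N ↦ (hasSum_finite_jacobi_triple_product hq hq0 hz0 N).tsum_eq] at hlim
  rw [tsum_mul_right, mul_inv_cancel₀ hE, one_mul] at hlim
  rw [← tendsto_nhds_unique hlim hprod]
  field_simp

lemma hasProd_one_sub_odd_pow {q : ℂ} (hq : ‖q‖ < 1) :
    HasProd (fun k : ℕ ↦ 1 - q ^ (2 * k + 1)) (eulerProd q / eulerProd (q ^ 2)) := by
  have hQ : ‖q ^ 2‖ < 1 := norm_pow_lt_one hq two_ne_zero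
  have hinj : (fun k : ℕ ↦ 2 * k + 1).Injective := fun a b h ↦ by simpa using h
  have hodd : Multipliable fun k : ℕ ↦ 1 - q ^ (2 * k + 1) := by
    simpa using multipliable_one_sub_mul_pow hq 1 hinj
  have heven : HasProd (fun k : ℕ ↦ 1 - q ^ (2 * k + 1 + 1)) (eulerProd (q ^ 2)) := by
    refine (hasProd_eulerProd hQ).congr_fun fun k ↦ ?_
    rw [← pow_mul]
    ring
  have h := (hodd.hasProd.even_mul_odd (f := fun n ↦ 1 - q ^ (n + 1)) heven).unique
    (hasProd_eulerProd hq)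
  rw [← h, mul_div_cancel_right₀ _ (eulerProd_ne_zero hQ)]
  exact hodd.hasProd

lemma tsum_neg_one_zpow_mul_zpow_sq {q : ℂ} (hq : ‖q‖ < 1) (hq0 : q ≠ 0) :
    ∑' n : ℤ, (-1 : ℂ) ^ n * q ^ (n ^ 2) = eulerProd q ^ 2 / eulerProd (q ^ 2) := by
  have hQ : ‖q ^ 2‖ < 1 := norm_pow_lt_one hq two_ne_zero
  have hE := eulerProd_ne_zero hQ
  have hO := hasProd_one_sub_odd_pow hq
  have h := (hO.mul hO).congr_fun (g := fun k ↦ (1 + -1 * q ^ (2 * k + 1)) *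
    (1 + (-1 : ℂ)⁻¹ * q ^ (2 * k + 1))) fun k ↦ by norm_num; ring
  rw [tsum_zpow_mul_zpow_sq hq hq0 (by simp), h.tprod_eq]
  field_simp

lemma G_eq {q : ℂ} (hq : ‖q‖ < 1) : G q = eulerProd q ^ 4 / eulerProd (q ^ 2) ^ 2 := by
  have hQ : ‖q ^ 2‖ < 1 := norm_pow_lt_one hq two_ne_zero
  have h := ((hasProd_eulerProd hq).pow 4).div₀ ((hasProd_eulerProd hQ).pow 2)
    (pow_ne_zero 2 (eulerProd_ne_zero hQ))
  simpa only [G, ← pow_mul] using h.tprod_eq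

lemma G_eq_tsum_sq {q : ℂ} (hq : ‖q‖ < 1) (hq0 : q ≠ 0) :
    G q = (∑' n : ℤ, (-1 : ℂ) ^ n * q ^ (n ^ 2)) ^ 2 := by
  rw [G_eq hq, tsum_neg_one_zpow_mul_zpow_sq hq hq0]
  ring

lemma j_isPrimitiveRoot : IsPrimitiveRoot j 3 := by
  simpa [j] using Complex.isPrimitiveRoot_exp 3 three_ne_zero

lemma norm_j : ‖j‖ = 1 := j_isPrimitiveRoot.norm'_eq_one three_ne_zero

lemma j_ne_zero : j ≠ 0 := j_isPrimitiveRoot.ne_zero three_ne_zero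

lemma j_sq_add_j_add_one : j ^ 2 + j + 1 = 0 := by
  have h := j_isPrimitiveRoot.geom_sum_eq_zero (by norm_num)
  simp only [sum_range_succ, range_zero, sum_empty] at h
  linear_combination h

lemma inv_j : j⁻¹ = j ^ 2 :=
  inv_eq_of_mul_eq_one_right (by rw [← j_isPrimitiveRoot.pow_eq_one]; ring)

lemma tsum_neg_j_zpow_mul_zpow_sq {q : ℂ} (hq : ‖q‖ < 1) (hq0 : q ≠ 0) :
    ∑' n : ℤ, (-j) ^ n * q ^ (n ^ 2) =
      eulerProd (q ^ 2) ^ 2 * eulerProd (q ^ 3) / (eulerProd q * eulerProd (q ^ 6)) := by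
  have hpow {k : ℕ} (hk : k ≠ 0) : ‖q ^ k‖ < 1 := norm_pow_lt_one hq hk
  have hE1 := eulerProd_ne_zero hq
  have hE2 := eulerProd_ne_zero (hpow two_ne_zero)
  have hE6 := eulerProd_ne_zero (hpow (k := 6) (by norm_num))
  have h := ((hasProd_one_sub_odd_pow (hpow three_ne_zero)).div₀ (hasProd_one_sub_odd_pow hq)
    (div_ne_zero hE1 hE2)).congr_fun (g := fun k ↦ (1 + -j * q ^ (2 * k + 1)) *
    (1 + (-j)⁻¹ * q ^ (2 * k + 1))) fun k ↦ by
      rw [eq_div_iff (one_sub_pow_ne_zero hq (Nat.succ_ne_zero _)), inv_neg, inv_j, ← pow_mul,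
        mul_comm 3, pow_mul]
      generalize q ^ (2 * k + 1) = x
      linear_combination (x ^ 2 - x) * (1 - (j - 1) * x) * j_sq_add_j_add_one
  rw [tsum_zpow_mul_zpow_sq hq hq0 (by simp [norm_j]), h.tprod_eq, ← pow_mul]
  field_simp

lemma tprod_eq_tsum_mul_tsum {q : ℂ} (hq : ‖q‖ < 1) (hq0 : q ≠ 0) :
    ∏' n : ℕ, (1 - q ^ (n + 1)) ^ 2 / (1 - q ^ (n + 1) + q ^ (2 * (n + 1))) =
      (∑' n : ℤ, (-1 : ℂ) ^ n * q ^ (n ^ 2)) * ∑' n : ℤ, (-j) ^ n * q ^ (n ^ 2) := by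
  have hpow {k : ℕ} (hk : k ≠ 0) : ‖q ^ k‖ < 1 := norm_pow_lt_one hq hk
  have hE1 := eulerProd_ne_zero hq
  have hE2 := eulerProd_ne_zero (hpow two_ne_zero)
  have hE6 := eulerProd_ne_zero (hpow (k := 6) (by norm_num))
  have h := ((((hasProd_eulerProd hq).mul (hasProd_eulerProd (hpow two_ne_zero))).mul
    (hasProd_eulerProd (hpow three_ne_zero))).div₀
    (hasProd_eulerProd (hpow (k := 6) (by norm_num))) hE6).congr_fun
    (g := fun n ↦ (1 - q ^ (n + 1)) ^ 2 / (1 - q ^ (n + 1) + q ^ (2 * (n + 1)))) fun n ↦ by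
      have h1 := one_sub_pow_ne_zero hq (Nat.succ_ne_zero n)
      have h6 := one_sub_pow_ne_zero (hpow (k := 6) (by norm_num)) (Nat.succ_ne_zero n)
      have e (m : ℕ) : (q ^ m) ^ (n + 1) = (q ^ (n + 1)) ^ m := by
        rw [← pow_mul, ← pow_mul, mul_comm]
      rw [Nat.succ_eq_add_one, e] at h6
      rw [pow_mul, e, e, e]
      generalize q ^ (n + 1) = x at *
      have h : 1 - x + x ^ 2 ≠ 0 := by
        intro h
        apply h6
        linear_combination (1 + x) * (1 - x ^ 3) * h
      rw [div_eq_div_iff h h6]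
      ring
  rw [h.tprod_eq, tsum_neg_one_zpow_mul_zpow_sq hq hq0, tsum_neg_j_zpow_mul_zpow_sq hq hq0]
  field_simp

lemma j_zpow_three_mul_add (m : ℤ) (r : ℕ) : j ^ (3 * m + r) = j ^ r := by
  rw [zpow_add₀ j_ne_zero, zpow_mul]
  simp [zpow_ofNat, j_isPrimitiveRoot.pow_eq_one]

lemma j_zpow_add_zpow_neg (n : ℤ) :
    j ^ n + j ^ (-n) = 2 + (1 - j ^ 2) * (j ^ (n ^ 2) - 1) ∧
      j ^ (2 * n ^ 2) = -j + (1 + j) * j ^ (n ^ 2) := by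
  have hj := j_sq_add_j_add_one
  obtain ⟨m, h | h | h⟩ : ∃ m : ℤ, n = 3 * m ∨ n = 3 * m + 1 ∨ n = 3 * m + 2 := ⟨n / 3, by omega⟩
  · rw [show n = 3 * m + (0 : ℕ) by simpa using h,
      show -(3 * m + (0 : ℕ)) = 3 * (-m) + (0 : ℕ) by push_cast; ring,
      show (3 * m + (0 : ℕ)) ^ 2 = 3 * (3 * m ^ 2) + (0 : ℕ) by push_cast; ring,
      show 2 * (3 * (3 * m ^ 2) + (0 : ℕ)) = 3 * (6 * m ^ 2) + (0 : ℕ) by push_cast; ring]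
    simp only [j_zpow_three_mul_add]
    constructor <;> ring
  · rw [show n = 3 * m + (1 : ℕ) by simpa using h,
      show -(3 * m + (1 : ℕ)) = 3 * (-m - 1) + (2 : ℕ) by push_cast; ring,
      show (3 * m + (1 : ℕ)) ^ 2 = 3 * (3 * m ^ 2 + 2 * m) + (1 : ℕ) by push_cast; ring,
      show 2 * (3 * (3 * m ^ 2 + 2 * m) + (1 : ℕ)) = 3 * (2 * (3 * m ^ 2 + 2 * m)) + (2 : ℕ) by
        push_cast; ring]
    simp only [j_zpow_three_mul_add]
    constructor
    · linear_combination (j - 1) * hj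
    · ring
  · rw [show n = 3 * m + (2 : ℕ) by simpa using h,
      show -(3 * m + (2 : ℕ)) = 3 * (-m - 1) + (1 : ℕ) by push_cast; ring,
      show (3 * m + (2 : ℕ)) ^ 2 = 3 * (3 * m ^ 2 + 4 * m + 1) + (1 : ℕ) by push_cast; ring,
      show 2 * (3 * (3 * m ^ 2 + 4 * m + 1) + (1 : ℕ)) =
        3 * (2 * (3 * m ^ 2 + 4 * m + 1)) + (2 : ℕ) by push_cast; ring]
    simp only [j_zpow_three_mul_add]
    constructor
    · linear_combination (j - 1) * hj
    · ring

lemma two_mul_tsum_neg_j {q : ℂ} (hq : ‖q‖ < 1) (hq0 : q ≠ 0) :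
    2 * ∑' n : ℤ, (-j) ^ n * q ^ (n ^ 2) =
      2 * (∑' n : ℤ, (-1 : ℂ) ^ n * q ^ (n ^ 2)) + (1 - j ^ 2) *
        ((∑' n : ℤ, (-1 : ℂ) ^ n * (j * q) ^ (n ^ 2)) -
          ∑' n : ℤ, (-1 : ℂ) ^ n * q ^ (n ^ 2)) := by
  have hjq : ‖j * q‖ < 1 := by simpa [norm_j] using hq
  have h0 := (summable_theta hq hq0 (z := -1) (by simp)).hasSum
  have h1 := (summable_theta hjq (mul_ne_zero j_ne_zero hq0) (z := -1) (by simp)).hasSum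
  have hF := (summable_theta hq hq0 (z := -j) (by simp [norm_j])).hasSum
  have hF' := (Equiv.hasSum_iff (Equiv.neg ℤ)).mpr hF
  rw [two_mul]
  refine (hF.add hF').unique
    (((h0.mul_left 2).add ((h1.sub h0).mul_left (1 - j ^ 2))).congr_fun fun n ↦ ?_)
  simp only [Function.comp, Equiv.neg_apply, neg_sq]
  rw [neg_eq_neg_one_mul j, mul_zpow, mul_zpow, mul_zpow, zpow_neg (-1 : ℂ), ← inv_zpow,
    show (-1 : ℂ)⁻¹ = -1 by norm_num]
  linear_combination (-1) ^ n * q ^ (n ^ 2) * (j_zpow_add_zpow_neg n).1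

lemma tsum_j_sq_mul {q : ℂ} (hq : ‖q‖ < 1) (hq0 : q ≠ 0) :
    ∑' n : ℤ, (-1 : ℂ) ^ n * (j ^ 2 * q) ^ (n ^ 2) =
      -j * (∑' n : ℤ, (-1 : ℂ) ^ n * q ^ (n ^ 2)) +
        (1 + j) * ∑' n : ℤ, (-1 : ℂ) ^ n * (j * q) ^ (n ^ 2) := by
  have hjq : ‖j * q‖ < 1 := by simpa [norm_j] using hq
  have h0 := (summable_theta hq hq0 (z := -1) (by simp)).hasSum
  have h1 := (summable_theta hjq (mul_ne_zero j_ne_zero hq0) (z := -1) (by simp)).hasSum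
  refine (((h0.mul_left (-j)).add (h1.mul_left (1 + j))).congr_fun fun n ↦ ?_).tsum_eq
  rw [mul_zpow, mul_zpow, ← zpow_natCast, ← zpow_mul, Nat.cast_ofNat]
  linear_combination (-1) ^ n * q ^ (n ^ 2) * (j_zpow_add_zpow_neg n).2

theorem eta_quotient_linear_relation (q : ℂ) (hq : ‖q‖ < 1) :
    (∏' n : ℕ, (1 - q ^ (n + 1)) ^ 2 / (1 - q ^ (n + 1) + q ^ (2 * (n + 1))))
      = 1 / 4 * G q + (1 - j) / 4 * G (j * q) + (1 - j ^ 2) / 4 * G (j ^ 2 * q) := by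
  have hj := j_sq_add_j_add_one
  rcases eq_or_ne q 0 with rfl | hq0
  · simp [G]
    linear_combination hj / 4
  rw [tprod_eq_tsum_mul_tsum hq hq0, G_eq_tsum_sq hq hq0,
    G_eq_tsum_sq (q := j * q) (by simpa [norm_j] using hq) (mul_ne_zero j_ne_zero hq0),
    G_eq_tsum_sq (q := j ^ 2 * q) (by simpa [norm_j] using hq)
      (mul_ne_zero (pow_ne_zero 2 j_ne_zero) hq0), tsum_j_sq_mul hq hq0]
  have h := two_mul_tsum_neg_j hq hq0
  generalize ∑' n : ℤ, (-j) ^ n * q ^ (n ^ 2) = F at *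
  generalize ∑' n : ℤ, (-1 : ℂ) ^ n * q ^ (n ^ 2) = a at *
  generalize ∑' n : ℤ, (-1 : ℂ) ^ n * (j * q) ^ (n ^ 2) = b at *
  linear_combination a / 2 * h + ((j ^ 2 - j + 1) / 4 * a ^ 2 + (1 - j ^ 2) / 2 * (a * b)
    - (1 - j) * (2 + j) / 4 * b ^ 2) * hj
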